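/- Let k = k(n) be a sequence of integers with 1 ≤ k(n) ≤ ⌊log₂ n − 2·log₂log₂ n⌋ (for all n large enough that this floor is at least 1). Then w.h.p. Q^n(k(n)) is disconnected. -/

import Mathlib

open scoped Classical
open Filter

noncomputable section

/-- The vertex set of the `n`-dimensional hypercube: `{0,1}^n`. -/
abbrev Vtx (n : ℕ) := Fin n → Bool

/-- The `n`-dimensional hypercube graph `Q^n`: two vertices are adjacent iff they
differ in exactly one coordinate. -/
def cubeGraph (n : ℕ) : SimpleGraph (Vtx n) :=
  SimpleGraph.fromRel (fun u v => hammingDist u v = 1)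

/-- Sample space for the `k`-out model on `Q^n`: each vertex `v` chooses a
`k`-element set of its neighbours (equivalently, `k` incident edges). -/
abbrev KOut (n k : ℕ) :=
  ∀ v : Vtx n, {s : Finset (Vtx n) // s.card = k ∧ ∀ u ∈ s, (cubeGraph n).Adj v u}

/-- The random subgraph `Q^n(k)` produced by an outcome of the `k`-out model:
`u` and `v` are adjacent iff one of them chose the edge between them. -/
def kOutGraph (n k : ℕ) (ω : KOut n k) : SimpleGraph (Vtx n) :=
  SimpleGraph.fromRel (fun u v => v ∈ (ω u).1)

/-- Uniform (counting) probability of an event on a finite sample space. -/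
def prob {Ω : Type*} [Finite Ω] (p : Ω → Prop) : ℝ :=
  (Nat.card {ω : Ω // p ω} : ℝ) / (Nat.card Ω : ℝ)

/-- Number of vertices in the connected component of `v` in `G`. -/
def compSize {V : Type*} (G : SimpleGraph V) (v : V) : ℕ :=
  Nat.card {w : V // G.Reachable v w}


section UniformProbability

variable {Ω Ω' : Type*} [Finite Ω] [Finite Ω']

lemma prob_nonneg (p : Ω → Prop) : 0 ≤ prob p := by unfold prob; positivity

lemma prob_mono {p q : Ω → Prop} (h : ∀ ω, p ω → q ω) : prob p ≤ prob q := by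
  unfold prob
  gcongr
  exact Nat.card_le_card_of_injective _ (Subtype.impEmbedding p q h).injective

lemma prob_true [Nonempty Ω] : prob (fun _ : Ω => True) = 1 := by
  unfold prob
  rw [Nat.card_congr (Equiv.subtypeUnivEquiv fun _ => trivial)]
  exact div_self (by exact_mod_cast Nat.card_pos.ne')

lemma prob_le_one [Nonempty Ω] (p : Ω → Prop) : prob p ≤ 1 :=
  (prob_mono fun _ _ => trivial).trans_eq prob_true

lemma prob_not [Nonempty Ω] (p : Ω → Prop) : prob (fun ω => ¬ p ω) = 1 - prob p := by
  have h : Nat.card Ω = Nat.card {ω // p ω} + Nat.card {ω // ¬ p ω} := by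
    rw [← Nat.card_sum]
    exact (Nat.card_congr (Equiv.sumCompl p)).symm
  have h0 : (Nat.card Ω : ℝ) ≠ 0 := by exact_mod_cast Nat.card_pos.ne'
  unfold prob
  rw [eq_sub_iff_add_eq, ← add_div, div_eq_one_iff_eq h0, h]
  push_cast
  ring

lemma prob_equiv (e : Ω ≃ Ω') (p : Ω' → Prop) : prob (fun ω => p (e ω)) = prob p := by
  unfold prob
  rw [Nat.card_congr e, Nat.card_congr (e.subtypeEquivOfSubtype (p := p))]

lemma prob_pi {I : Type*} [Fintype I] {X : I → Type*} [∀ i, Finite (X i)]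
    (E : ∀ i, X i → Prop) :
    prob (fun x : ∀ i, X i => ∀ i, E i (x i)) = ∏ i, prob (E i) := by
  unfold prob
  rw [Nat.card_congr (Equiv.subtypePiEquivPi (p := E)), Nat.card_pi, Nat.card_pi,
    Finset.prod_div_distrib]
  push_cast
  rfl

/-- The coordinates of a dependent function, grouped along the fibres of `f`. -/
def piFiberEquiv {V I : Type*} (S : V → Type*) (f : V → I) :
    (∀ v, S v) ≃ ∀ i, ∀ v : {v // f v = i}, S v where
  toFun ω _ v := ω v
  invFun x v := x (f v) ⟨v, rfl⟩
  left_inv _ := rfl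
  right_inv x := by
    funext i ⟨v, hv⟩
    subst hv
    rfl

lemma prob_block_fails_le {V I : Type*} [Fintype V] [Fintype I] (S : V → Type*)
    [∀ v, Finite (S v)] [∀ v, Nonempty (S v)] (T : ∀ v, S v → Prop) (f : V → I)
    (J : Finset I) {p : ℝ}
    (hp : ∀ i ∈ J, p ≤ ∏ v with f v = i, prob (T v)) :
    prob (fun ω : ∀ v, S v => ∀ i ∈ J, ∃ v, f v = i ∧ ¬ T v (ω v)) ≤ (1 - p) ^ J.card := by
  let E : ∀ i, (∀ v : {v // f v = i}, S v) → Prop :=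
    fun i x => i ∈ J → ¬ ∀ v : {v // f v = i}, T v (x v)
  have h1 : prob (fun ω : ∀ v, S v => ∀ i ∈ J, ∃ v, f v = i ∧ ¬ T v (ω v)) =
      ∏ i, prob (E i) := by
    rw [← prob_pi, ← prob_equiv (piFiberEquiv S f)]
    congr 1
    funext ω
    simp [E, piFiberEquiv]
  rw [h1, ← Finset.prod_subset (Finset.subset_univ J), ← Finset.prod_const]
  · refine Finset.prod_le_prod (fun i _ => prob_nonneg _) fun i hi => ?_
    have h2 : prob (E i) = 1 - prob (fun x : ∀ v : {v // f v = i}, S v =>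
        ∀ v : {v // f v = i}, T v (x v)) := by
      rw [← prob_not]
      simp [E, hi]
    have h3 := hp i hi
    rw [h2, prob_pi (fun v : {v // f v = i} => T v)]
    rw [Finset.prod_subtype (p := fun v => f v = i) _ (by simp)] at h3
    linarith
  · intro i _ hi
    simp only [E, hi, false_imp_iff]
    exact prob_true

end UniformProbability

section Hypercube

variable {n : ℕ}

/-- The neighbour of `v` in direction `i`. -/
def flipAt (v : Vtx n) (i : Fin n) : Vtx n := Function.update v i (!v i)

lemma flipAt_flipAt (v : Vtx n) (i : Fin n) : flipAt (flipAt v i) i = v := by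
  simp [flipAt]

lemma flipAt_apply_ne (v : Vtx n) {i j : Fin n} (h : j ≠ i) : flipAt v i j = v j := by
  simp [flipAt, h]

lemma flipAt_apply_self (v : Vtx n) (i : Fin n) : flipAt v i i = !v i := by
  simp [flipAt]

lemma flipAt_injective (v : Vtx n) : Function.Injective (flipAt v) := by
  intro i j h
  by_contra hij
  have := congrFun h i
  rw [flipAt_apply_self, flipAt_apply_ne v hij] at this
  simp at this

lemma hammingDist_eq_one_iff {u v : Vtx n} : hammingDist u v = 1 ↔ ∃ i, v = flipAt u i := by
  rw [hammingDist, Finset.card_eq_one]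
  refine exists_congr fun i => ⟨fun h => ?_, fun h => ?_⟩
  · funext j
    have hj := Finset.ext_iff.1 h j
    simp only [Finset.mem_filter, Finset.mem_univ, true_and, Finset.mem_singleton] at hj
    by_cases hij : j = i
    · subst hij
      rw [flipAt_apply_self]
      have := hj.2 rfl
      revert this
      cases u j <;> cases v j <;> simp
    · rw [flipAt_apply_ne _ hij]
      by_contra hne
      exact hij (hj.1 (Ne.symm hne))
  · subst h
    ext j
    by_cases hij : j = i
    · subst hij
      simp [flipAt_apply_self]
    · simp [flipAt_apply_ne _ hij, hij]

lemma cubeGraph_adj {u v : Vtx n} : (cubeGraph n).Adj u v ↔ ∃ i, v = flipAt u i := by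
  rw [cubeGraph, SimpleGraph.fromRel_adj, hammingDist_comm v u, or_self, hammingDist_eq_one_iff]
  refine ⟨fun h => h.2, fun h => ⟨?_, h⟩⟩
  rintro rfl
  obtain ⟨i, hi⟩ := h
  have := congrFun hi i
  rw [flipAt_apply_self] at this
  simp at this

/-- The directions in which the neighbour of `v` satisfies `q`. -/
def goodDirections (v : Vtx n) (q : Vtx n → Prop) : Finset (Fin n) :=
  Finset.univ.filter fun i => q (flipAt v i)

lemma card_choices (k : ℕ) (v : Vtx n) (q : Vtx n → Prop) :
    Nat.card {s : {s : Finset (Vtx n) // s.card = k ∧ ∀ u ∈ s, (cubeGraph n).Adj v u} //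
      ∀ u ∈ s.1, q u} = (goodDirections v q).card.choose k := by
  rw [← Finset.card_map ⟨flipAt v, flipAt_injective v⟩, ← Finset.card_powersetCard,
    ← Nat.card_eq_finsetCard]
  refine Nat.card_congr ((Equiv.subtypeSubtypeEquivSubtypeInter
    (fun s : Finset (Vtx n) => s.card = k ∧ ∀ u ∈ s, (cubeGraph n).Adj v u)
    (fun s => ∀ u ∈ s, q u)).trans (Equiv.subtypeEquivRight fun s => ?_))
  simp only [Finset.mem_powersetCard, goodDirections,
    Finset.subset_iff, Finset.mem_map, Finset.mem_filter, Finset.mem_univ, true_and,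
    Function.Embedding.coeFn_mk, cubeGraph_adj]
  constructor
  · rintro ⟨⟨h1, h2⟩, h3⟩
    refine ⟨fun u hu => ?_, h1⟩
    obtain ⟨i, rfl⟩ := h2 u hu
    exact ⟨i, h3 _ hu, rfl⟩
  · rintro ⟨h1, h2⟩
    refine ⟨⟨h2, fun u hu => ?_⟩, fun u hu => ?_⟩
    · obtain ⟨i, _, rfl⟩ := h1 hu
      exact ⟨i, rfl⟩
    · obtain ⟨i, hi, rfl⟩ := h1 hu
      exact hi

lemma card_all_choices (k : ℕ) (v : Vtx n) :
    Nat.card {s : Finset (Vtx n) // s.card = k ∧ ∀ u ∈ s, (cubeGraph n).Adj v u} =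
      n.choose k := by
  have h := card_choices k v fun _ => True
  rw [Nat.card_congr (Equiv.subtypeUnivEquiv fun _ _ _ => trivial)] at h
  simpa [goodDirections] using h

lemma prob_choice (k : ℕ) (v : Vtx n) (q : Vtx n → Prop) :
    prob (fun s : {s : Finset (Vtx n) // s.card = k ∧ ∀ u ∈ s, (cubeGraph n).Adj v u} =>
      ∀ u ∈ s.1, q u) = ((goodDirections v q).card.choose k : ℝ) / (n.choose k : ℝ) := by
  rw [prob, card_choices, card_all_choices]

lemma nonempty_choices {k : ℕ} (hk : k ≤ n) (v : Vtx n) :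
    Nonempty {s : Finset (Vtx n) // s.card = k ∧ ∀ u ∈ s, (cubeGraph n).Adj v u} := by
  refine (Nat.card_pos_iff.1 ?_).1
  rw [card_all_choices]
  exact Nat.choose_pos hk

/-- The base point of the `k`-dimensional subcube through `v` spanned by the first `k`
directions. -/
def base (k : ℕ) (v : Vtx n) : Vtx n := fun i => if i.1 < k then false else v i

lemma base_flipAt_of_lt {k : ℕ} (v : Vtx n) {i : Fin n} (h : i.1 < k) :
    base k (flipAt v i) = base k v := by
  funext j
  by_cases hj : j = i
  · subst hj
    simp [base, h]
  · simp [base, flipAt_apply_ne v hj]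

lemma base_flipAt_of_le {k : ℕ} (v : Vtx n) {i : Fin n} (h : k ≤ i.1) :
    base k (flipAt v i) = flipAt (base k v) i := by
  funext j
  by_cases hj : j = i
  · subst hj
    simp [base, flipAt_apply_self, h.not_gt]
  · simp [base, flipAt_apply_ne _ hj]

lemma card_base_eq_le (k : ℕ) (z : Vtx n) :
    (Finset.univ.filter fun v : Vtx n => base k v = z).card ≤ 2 ^ k := by
  have : (Finset.univ : Finset (Fin k → Bool)).card = 2 ^ k := by simp
  rw [← this]
  refine Finset.card_le_card_of_injOn
    (fun v i => if h : i.1 < n then v ⟨i.1, h⟩ else false) (by simp) ?_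
  intro u hu v hv h
  simp only [Finset.coe_filter, Finset.mem_univ, true_and, Set.mem_ofPred_eq] at hu hv
  funext i
  by_cases hi : i.1 < k
  · simpa using congrFun h ⟨i.1, hi⟩
  · have := congrFun (hu.trans hv.symm) i
    simpa [base, hi] using this

lemma card_base_points {k : ℕ} (hk : k ≤ n) :
    (Finset.univ.filter fun z : Vtx n => base k z = z).card = 2 ^ (n - k) := by
  have h : (Finset.univ.filter fun z : Vtx n => base k z = z) =
      Fintype.piFinset fun i : Fin n => if i.1 < k then {false} else Finset.univ := by
    ext z
    simp only [Finset.mem_filter, Finset.mem_univ, true_and, Fintype.mem_piFinset, funext_iff, base]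
    refine forall_congr' fun i => ?_
    split_ifs with hi
    · rw [Finset.mem_singleton]
      exact eq_comm
    · simp
  rw [h, Fintype.card_piFinset]
  have h2 : ∀ i : Fin n, (if i.1 < k then ({false} : Finset Bool) else Finset.univ).card =
      if i.1 < k then 1 else 2 := by
    intro i
    split_ifs <;> simp
  simp only [h2, Finset.prod_ite, Finset.prod_const, one_pow, one_mul]
  congr 1
  have h3 := Finset.card_filter_add_card_filter_not (s := (Finset.univ : Finset (Fin n)))
    (fun i => i.1 < k)
  have h4 : (Finset.univ.filter fun i : Fin n => i.1 < k).card = k := by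
    rw [Fin.card_filter_val_lt]
    omega
  rw [Finset.card_univ, Fintype.card_fin, h4] at h3
  omega

/-- A point at Hamming distance at most one from `z`. -/
def Near (w z : Vtx n) : Prop := w = z ∨ ∃ i, w = flipAt z i

lemma exists_syndrome (n r : ℕ) (h : n + 1 ≤ 2 ^ r) :
    ∃ g : Fin n → Fin r → ZMod 2, Function.Injective g ∧ ∀ i, g i ≠ 0 := by
  obtain ⟨e⟩ : Nonempty (Option (Fin n) ↪ (Fin r → ZMod 2)) :=
    Function.Embedding.nonempty_of_card_le (by simpa [ZMod.card] using h)
  refine ⟨fun i => e (some i) - e none, fun i j hij => ?_, fun i hi => ?_⟩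
  · simpa using hij
  · simpa using e.injective (sub_eq_zero.1 hi)

lemma sum_flipAt {r : ℕ} (g : Fin n → Fin r → ZMod 2) (v : Vtx n) (i : Fin n) :
    (∑ j, if flipAt v i j then g j else 0) = (∑ j, if v j then g j else 0) + g i := by
  rw [← Finset.sum_erase_add _ _ (Finset.mem_univ i),
    ← Finset.sum_erase_add _ (fun j => if v j then g j else 0) (Finset.mem_univ i),
    flipAt_apply_self]
  have h : ∀ j ∈ Finset.univ.erase i, (if flipAt v i j then g j else 0) =
      if v j then g j else 0 := by
    intro j hj
    rw [flipAt_apply_ne v (Finset.ne_of_mem_erase hj)]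
  rw [Finset.sum_congr rfl h]
  cases v i
  · simp
  · simp [add_assoc, ZModModule.add_self]

/-- There is a large set of base points whose unit balls are pairwise disjoint. -/
lemma exists_code {k r : ℕ} (hk : k ≤ n) (hr : n + 1 ≤ 2 ^ r) :
    ∃ C : Finset (Vtx n), (∀ z ∈ C, base k z = z) ∧ 2 ^ (n - k) ≤ 2 ^ r * C.card ∧
      ∀ w, ∀ z ∈ C, ∀ z' ∈ C, Near w z → Near w z' → z = z' := by
  obtain ⟨g, hg, hg0⟩ := exists_syndrome n r hr
  let s : Vtx n → Fin r → ZMod 2 := fun v => ∑ j, if v j then g j else 0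
  have hs : ∀ v i, s (flipAt v i) = s v + g i := sum_flipAt g
  obtain ⟨c, hc⟩ : ∃ c, 2 ^ (n - k) ≤
      2 ^ r * ((Finset.univ.filter fun z : Vtx n => base k z = z).filter fun z => s z = c).card := by
    by_contra! hlt
    have h1 := Finset.card_eq_sum_card_fiberwise
      (s := Finset.univ.filter fun z : Vtx n => base k z = z) (f := s) (t := Finset.univ)
      (by simp)
    rw [card_base_points hk] at h1
    have h2 : 2 ^ r * 2 ^ (n - k) < ∑ _c : Fin r → ZMod 2, 2 ^ (n - k) := by
      rw [h1, Finset.mul_sum, ← h1]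
      exact Finset.sum_lt_sum_of_nonempty Finset.univ_nonempty fun c _ => hlt c
    simp [ZMod.card] at h2
  refine ⟨_, ?_, hc, ?_⟩
  · intro z hz
    simp only [Finset.mem_filter] at hz
    exact hz.1.2
  · intro w z hz z' hz' h h'
    replace hz := (Finset.mem_filter.1 hz).2
    replace hz' := (Finset.mem_filter.1 hz').2
    rcases h with rfl | ⟨i, rfl⟩ <;> rcases h' with h' | ⟨j, h'⟩
    · exact h'
    · rw [h', hs, hz'] at hz
      exact absurd (by simpa using hz) (hg0 j)
    · rw [← h', hs, hz] at hz'
      exact absurd (by simpa using hz') (hg0 i)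
    · have h1 := congrArg s h'
      rw [hs, hs, hz, hz', add_right_inj] at h1
      obtain rfl := hg h1
      rw [← flipAt_flipAt z i, h', flipAt_flipAt]

/-- The choice at a vertex `v` respects the subcube with base point `z`. -/
def Respects (k : ℕ) (z v u : Vtx n) : Prop := base k u = z ↔ base k v = z

lemma not_connected_of_respects {k : ℕ} (hk : k < n) (ω : KOut n k) {z : Vtx n}
    (hz : base k z = z)
    (h : ∀ v, Near (base k v) z → ∀ u ∈ (ω v).1, Respects k z v u) :
    ¬ (kOutGraph n k ω).Connected := by
  intro hconn
  have key : ∀ u v, v ∈ (ω u).1 → (base k v = z ↔ base k u = z) := by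
    intro u v huv
    by_cases hu : base k u = z
    · exact h u (Or.inl hu) v huv
    by_cases hv : base k v = z
    · refine h u (Or.inr ?_) v huv
      obtain ⟨i, rfl⟩ := cubeGraph_adj.1 ((ω u).2.2 v huv)
      refine ⟨i, ?_⟩
      rcases lt_or_ge i.1 k with hi | hi
      · exact absurd ((base_flipAt_of_lt u hi).symm.trans hv) hu
      · rw [← hv, base_flipAt_of_le u hi]
        exact (flipAt_flipAt _ _).symm
    · simp [hu, hv]
  have hwalk : ∀ u v, (kOutGraph n k ω).Reachable u v → (base k u = z ↔ base k v = z) := by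
    rintro u v ⟨p⟩
    induction p with
    | nil => rfl
    | cons hadj _ ih =>
      rw [← ih]
      rw [kOutGraph, SimpleGraph.fromRel_adj] at hadj
      rcases hadj.2 with h1 | h1
      · exact (key _ _ h1).symm
      · exact key _ _ h1
  have h1 := (hwalk _ _ (hconn.preconnected z (flipAt z ⟨k, hk⟩))).1 hz
  rw [base_flipAt_of_le z (i := ⟨k, hk⟩) le_rfl, hz] at h1
  have h2 := congrFun h1 ⟨k, hk⟩
  rw [flipAt_apply_self] at h2
  simp at h2

lemma prob_respects_inside {k : ℕ} (hk : k ≤ n) (v z : Vtx n) :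
    ((n : ℝ) ^ k)⁻¹ ≤
      prob (fun s : {s : Finset (Vtx n) // s.card = k ∧ ∀ u ∈ s, (cubeGraph n).Adj v u} =>
        ∀ u ∈ s.1, Respects k z v u) := by
  rw [prob_choice]
  have h1 : k ≤ (goodDirections v (Respects k z v)).card := by
    calc k = (Finset.univ.filter fun i : Fin n => i.1 < k).card := by
          rw [Fin.card_filter_val_lt]
          omega
      _ ≤ _ := by
          refine Finset.card_le_card fun i hi => ?_
          simp only [Finset.mem_filter, Finset.mem_univ, true_and] at hi
          exact Finset.mem_filter.2 ⟨Finset.mem_univ i, by rw [Respects, base_flipAt_of_lt v hi]⟩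
  have h2 : (1 : ℝ) ≤ ((goodDirections v (Respects k z v)).card.choose k : ℝ) := by
    exact_mod_cast Nat.choose_pos h1
  have h3 : (0 : ℝ) < (n.choose k : ℝ) := by exact_mod_cast Nat.choose_pos hk
  have h4 : (n.choose k : ℝ) ≤ (n : ℝ) ^ k := by exact_mod_cast Nat.choose_le_pow n k
  calc ((n : ℝ) ^ k)⁻¹ ≤ (n.choose k : ℝ)⁻¹ := by gcongr
    _ = 1 / (n.choose k : ℝ) := by rw [one_div]
    _ ≤ _ := by gcongr

lemma prob_respects_outside {k : ℕ} (hk : k < n) (v z : Vtx n) (h : base k v ≠ z) :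
    1 - (k : ℝ) / n ≤
      prob (fun s : {s : Finset (Vtx n) // s.card = k ∧ ∀ u ∈ s, (cubeGraph n).Adj v u} =>
        ∀ u ∈ s.1, Respects k z v u) := by
  rw [prob_choice]
  have h1 : n - 1 ≤ (goodDirections v (Respects k z v)).card := by
    have h2 := Finset.card_filter_add_card_filter_not (s := (Finset.univ : Finset (Fin n)))
      (fun i => Respects k z v (flipAt v i))
    have h3 : (Finset.univ.filter fun i => ¬ Respects k z v (flipAt v i)).card ≤ 1 := by
      refine Finset.card_le_one.2 fun i hi j hj => ?_
      simp only [Finset.mem_filter, Finset.mem_univ, true_and, Respects, h, iff_false,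
        not_not] at hi hj
      have big : ∀ l : Fin n, base k (flipAt v l) = z → k ≤ l.1 := by
        intro l hl
        by_contra! hlt
        exact h ((base_flipAt_of_lt v hlt).symm.trans hl)
      rw [base_flipAt_of_le v (big i hi)] at hi
      rw [base_flipAt_of_le v (big j hj)] at hj
      exact flipAt_injective _ (hi.trans hj.symm)
    rw [Finset.card_univ, Fintype.card_fin] at h2
    unfold goodDirections
    omega
  have h3 : (0 : ℝ) < (n.choose k : ℝ) := by exact_mod_cast Nat.choose_pos hk.le
  have hn : (0 : ℝ) < n := by exact_mod_cast (Nat.zero_le k).trans_lt hk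
  have h4 : ((n - 1).choose k : ℝ) * n = n.choose k * ((n : ℝ) - k) := by
    have h5 := Nat.choose_mul_succ_eq (n - 1) k
    rw [Nat.sub_add_cancel (by omega : 1 ≤ n)] at h5
    rw [← Nat.cast_sub hk.le]
    exact_mod_cast h5
  have h6 : 1 - (k : ℝ) / n = ((n - 1).choose k : ℝ) / n.choose k := by
    field_simp
    linarith
  rw [h6]
  gcongr

lemma card_near_outside_le (k : ℕ) (z : Vtx n) :
    (Finset.univ.filter fun v : Vtx n => Near (base k v) z ∧ base k v ≠ z).card ≤ 2 ^ k * n := by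
  calc _ ≤ (Finset.univ.biUnion fun i : Fin n =>
        Finset.univ.filter fun v : Vtx n => base k v = flipAt z i).card := by
        refine Finset.card_le_card fun v hv => ?_
        simp only [Finset.mem_filter, Finset.mem_univ, true_and] at hv
        obtain ⟨i, hi⟩ := hv.1.resolve_left hv.2
        simpa using ⟨i, hi⟩
    _ ≤ _ := by
        refine (Finset.card_biUnion_le_card_mul _ _ (2 ^ k)
          fun i _ => card_base_eq_le k (flipAt z i)).trans_eq ?_
        simp [mul_comm]

/-- A lower bound for the probability that a given `k`-dimensional subcube is separated. -/
def separationBound (n k : ℕ) : ℝ :=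
  ((n : ℝ) ^ k)⁻¹ ^ 2 ^ k * (1 - (k : ℝ) / n) ^ (2 ^ k * n)

lemma pow_le_prod_of_card_le {ι : Type*} (s : Finset ι) (f : ι → ℝ) {a : ℝ} {m : ℕ}
    (ha0 : 0 ≤ a) (ha1 : a ≤ 1) (hm : s.card ≤ m) (h : ∀ i ∈ s, a ≤ f i) :
    a ^ m ≤ ∏ i ∈ s, f i :=
  calc a ^ m ≤ a ^ s.card := pow_le_pow_of_le_one ha0 ha1 hm
    _ = ∏ _i ∈ s, a := (Finset.prod_const a).symm
    _ ≤ _ := Finset.prod_le_prod (fun _ _ => ha0) h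

lemma prob_connected_le {k r : ℕ} (hk : k < n) (hr : n + 1 ≤ 2 ^ r) :
    ∃ N : ℕ, 2 ^ (n - k) ≤ 2 ^ r * N ∧
      prob (fun ω : KOut n k => (kOutGraph n k ω).Connected) ≤ (1 - separationBound n k) ^ N ∧
      separationBound n k ≤ 1 := by
  obtain ⟨C, hCbase, hCcard, hCuniq⟩ := exists_code hk.le hr
  have hn : (0 : ℝ) < n := by exact_mod_cast (Nat.zero_le k).trans_lt hk
  have hn1 : (1 : ℝ) ≤ n := by exact_mod_cast (Nat.zero_le k).trans_lt hk
  have ha0 : (0 : ℝ) ≤ ((n : ℝ) ^ k)⁻¹ := by positivity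
  have ha1 : ((n : ℝ) ^ k)⁻¹ ≤ 1 := inv_le_one_of_one_le₀ (one_le_pow₀ hn1)
  have hb0 : 0 ≤ 1 - (k : ℝ) / n := by
    rw [sub_nonneg, div_le_one hn]
    exact_mod_cast hk.le
  have hb1 : 1 - (k : ℝ) / n ≤ 1 := by
    have : 0 ≤ (k : ℝ) / n := by positivity
    linarith
  have hsep : separationBound n k ≤ 1 :=
    mul_le_one₀ (pow_le_one₀ ha0 ha1) (pow_nonneg hb0 _) (pow_le_one₀ hb0 hb1)
  refine ⟨C.card, hCcard, ?_, hsep⟩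
  obtain ⟨f, hf⟩ : ∃ f : Vtx n → Option (Vtx n),
      ∀ v, ∀ z ∈ C, f v = some z ↔ Near (base k v) z := by
    refine ⟨fun v => if h : ∃ z ∈ C, Near (base k v) z then some h.choose else none,
      fun v z hz => ?_⟩
    by_cases h : ∃ z ∈ C, Near (base k v) z
    · have hspec := h.choose_spec
      simp only [dif_pos h]
      rw [Option.some_inj]
      refine ⟨fun he => he ▸ hspec.2, fun hnear => ?_⟩
      exact hCuniq _ _ hspec.1 _ hz hspec.2 hnear
    · simp only [dif_neg h, reduceCtorEq, false_iff]
      exact fun hnear => h ⟨z, hz, hnear⟩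
  let S : Vtx n → Type := fun v =>
    {s : Finset (Vtx n) // s.card = k ∧ ∀ u ∈ s, (cubeGraph n).Adj v u}
  let T : ∀ v, S v → Prop := fun v s => ∀ z, f v = some z → ∀ u ∈ s.1, Respects k z v u
  have hT : ∀ v z, f v = some z → T v = fun s => ∀ u ∈ s.1, Respects k z v u := by
    intro v z hv
    funext s
    simp [T, hv]
  have : ∀ v, Nonempty (S v) := nonempty_choices hk.le
  refine le_trans (prob_mono ?_)
    ((prob_block_fails_le S T f (C.map Function.Embedding.some) ?_).trans_eq
      (by rw [Finset.card_map]))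
  · intro ω hconn i hi
    obtain ⟨z, hz, rfl⟩ := Finset.mem_map.1 hi
    by_contra! hall
    refine not_connected_of_respects hk ω (hCbase z hz) (fun v hv => ?_) hconn
    have hv' := (hf v z hz).2 hv
    exact hall v hv' z hv'
  · intro i hi
    obtain ⟨z, hz, rfl⟩ := Finset.mem_map.1 hi
    simp only [Function.Embedding.some_apply]
    rw [← Finset.prod_filter_mul_prod_filter_not _ (fun v => base k v = z),
      Finset.filter_filter, Finset.filter_filter]
    refine mul_le_mul ?_ ?_ (pow_nonneg hb0 _) (Finset.prod_nonneg fun v _ => prob_nonneg _)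
    · refine pow_le_prod_of_card_le _ _ ha0 ha1 ?_ fun v hv => ?_
      · refine (Finset.card_le_card fun v hv => ?_).trans (card_base_eq_le k z)
        simp only [Finset.mem_filter, Finset.mem_univ, true_and] at hv ⊢
        exact hv.2
      · simp only [Finset.mem_filter, Finset.mem_univ, true_and] at hv
        rw [hT v z hv.1]
        exact prob_respects_inside hk.le v z
    · refine pow_le_prod_of_card_le _ _ hb0 hb1 ?_ fun v hv => ?_
      · refine (Finset.card_le_card fun v hv => ?_).trans (card_near_outside_le k z)
        simp only [Finset.mem_filter, Finset.mem_univ, true_and] at hv ⊢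
        exact ⟨(hf v z hz).1 hv.1, hv.2⟩
      · simp only [Finset.mem_filter, Finset.mem_univ, true_and] at hv
        rw [hT v z hv.1]
        exact prob_respects_outside hk v z hv.2

end Hypercube

section Asymptotics

lemma two_rpow_neg_le {x : ℝ} (hx0 : 0 ≤ x) (hx : x ≤ 1 / 2) : (2 : ℝ) ^ (-(3 * x)) ≤ 1 - x := by
  have hpos : 0 < 1 - x := by linarith
  have h1 : (1 - x)⁻¹ ≤ Real.exp (2 * x) := by
    refine le_trans ?_ (Real.add_one_le_exp _)
    rw [inv_le_iff_one_le_mul₀ hpos]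
    nlinarith
  have h2 : Real.exp (2 * x) ≤ 2 ^ (3 * x) := by
    rw [Real.rpow_def_of_pos two_pos, Real.exp_le_exp]
    nlinarith [Real.log_two_gt_d9]
  rw [Real.rpow_neg two_pos.le]
  exact inv_le_of_inv_le₀ hpos (h1.trans h2)

lemma two_rpow_le_separationBound {n k : ℕ} {L : ℝ} (hn : (n : ℝ) = 2 ^ L)
    (hk : 2 * (k : ℝ) ≤ n) :
    (2 : ℝ) ^ (-(k * 2 ^ k * (L + 3))) ≤ separationBound n k := by
  have hn0 : (0 : ℝ) < n := hn ▸ Real.rpow_pos_of_pos two_pos L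
  have h1 : (2 : ℝ) ^ (-(3 * ((k : ℝ) / n))) ≤ 1 - (k : ℝ) / n := by
    refine two_rpow_neg_le (by positivity) ?_
    rw [div_le_div_iff₀ hn0 two_pos]
    linarith
  have h2 : ((n : ℝ) ^ k)⁻¹ ^ 2 ^ k = (2 : ℝ) ^ (-(L * k * 2 ^ k)) := by
    rw [hn, ← Real.rpow_mul_natCast two_pos.le, ← Real.rpow_neg two_pos.le,
      ← Real.rpow_mul_natCast two_pos.le]
    congr 1
    push_cast
    ring
  have h3 : ((2 : ℝ) ^ (-(3 * ((k : ℝ) / n)))) ^ (2 ^ k * n) = (2 : ℝ) ^ (-(3 * k * 2 ^ k : ℝ)) := by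
    rw [← Real.rpow_mul_natCast two_pos.le]
    congr 1
    push_cast
    field_simp
  have h4 : (2 : ℝ) ^ (-(k * 2 ^ k * (L + 3))) =
      2 ^ (-(L * k * 2 ^ k)) * 2 ^ (-(3 * k * 2 ^ k : ℝ)) := by
    rw [← Real.rpow_add two_pos]
    congr 1
    ring
  rw [separationBound, h4, h2, ← h3]
  gcongr

lemma le_separationBound_mul {n k N : ℕ} (hL : 4 ≤ Real.logb 2 n)
    (hLn : 4 * Real.logb 2 n ^ 2 ≤ n)
    (hk : (k : ℝ) ≤ Real.logb 2 n - 2 * Real.logb 2 (Real.logb 2 n))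
    (hN : (2 : ℝ) ^ (n - k) ≤ 2 * n * N) :
    (n : ℝ) ≤ separationBound n k * N := by
  set L := Real.logb 2 n with hLdef
  set l := Real.logb 2 L with hldef
  have hL0 : 0 < L := by linarith
  have hn0 : (0 : ℝ) < n := by nlinarith
  have hn : (n : ℝ) = 2 ^ L := (Real.rpow_logb two_pos (by norm_num) hn0).symm
  have hLl : L = 2 ^ l := (Real.rpow_logb two_pos (by norm_num) hL0).symm
  have hl : 2 ≤ l := by
    rw [hldef, Real.le_logb_iff_rpow_le (by norm_num) hL0]
    norm_num
    exact hL
  have hkL : (k : ℝ) ≤ L := by linarith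
  have hkn : 2 * (k : ℝ) ≤ n := by nlinarith
  have hkn' : k ≤ n := by
    have : (k : ℝ) ≤ n := by linarith [Nat.cast_nonneg (α := ℝ) k]
    exact_mod_cast this
  have hpow : (2 : ℝ) ^ k * L ^ 2 ≤ n := by
    rw [hn, ← Real.rpow_natCast, hLl, ← hLl, show L ^ 2 = (2 : ℝ) ^ (l * (2 : ℕ)) by
      rw [Real.rpow_mul_natCast two_pos.le, ← hLl], ← Real.rpow_add two_pos]
    refine Real.rpow_le_rpow_of_exponent_le (by norm_num) ?_
    push_cast
    linarith
  have hexp : k * 2 ^ k * (L + 3) ≤ n - n / L := by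
    have h1 : k * (L + 3) ≤ L ^ 2 - L := by nlinarith
    have h2 : (n : ℝ) - n / L = n / L ^ 2 * (L ^ 2 - L) := by field_simp
    rw [h2]
    calc k * 2 ^ k * (L + 3) = 2 ^ k * (k * (L + 3)) := by ring
      _ ≤ n / L ^ 2 * (L ^ 2 - L) := by
        refine mul_le_mul ?_ h1 (by positivity) (by positivity)
        rwa [le_div_iff₀ (by positivity)]
  have hnL : 4 * L ≤ n / L := by
    rw [le_div_iff₀ hL0]
    nlinarith
  have hN' : (2 : ℝ) ^ ((n : ℝ) - k - 1 - L) ≤ N := by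
    rw [Real.rpow_sub two_pos, Real.rpow_sub two_pos, ← hn, Real.rpow_one,
      ← Nat.cast_sub hkn', Real.rpow_natCast, div_div, div_le_iff₀ (by positivity)]
    linarith
  calc (n : ℝ) = 2 ^ L := hn
    _ ≤ 2 ^ (-(k * 2 ^ k * (L + 3)) + ((n : ℝ) - k - 1 - L)) :=
      Real.rpow_le_rpow_of_exponent_le (by norm_num) (by linarith)
    _ = 2 ^ (-(k * 2 ^ k * (L + 3))) * 2 ^ ((n : ℝ) - k - 1 - L) := Real.rpow_add two_pos _ _
    _ ≤ separationBound n k * N := by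
      refine mul_le_mul (two_rpow_le_separationBound hn hkn) hN' (by positivity) ?_
      exact (Real.rpow_pos_of_pos two_pos _).le.trans (two_rpow_le_separationBound hn hkn)

lemma prob_connected_le_exp {n k : ℕ} (hL : 4 ≤ Real.logb 2 n)
    (hLn : 4 * Real.logb 2 n ^ 2 ≤ n)
    (hk : (k : ℝ) ≤ Real.logb 2 n - 2 * Real.logb 2 (Real.logb 2 n)) :
    k < n ∧ prob (fun ω : KOut n k => (kOutGraph n k ω).Connected) ≤ Real.exp (-n) := by
  have hkn : k < n := by
    have hl : 0 ≤ Real.logb 2 (Real.logb 2 n) := Real.logb_nonneg (by norm_num) (by linarith)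
    have : (k : ℝ) < n := by nlinarith
    exact_mod_cast this
  refine ⟨hkn, ?_⟩
  obtain ⟨N, hN, hprob, hsep⟩ :=
    prob_connected_le (r := Nat.log 2 n + 1) hkn (Nat.lt_pow_succ_log_self one_lt_two n)
  have hN2 : (2 : ℝ) ^ (n - k) ≤ 2 * n * N := by
    have h1 : 2 ^ Nat.log 2 n ≤ n := Nat.pow_log_le_self 2 (by omega)
    have h2 : 2 ^ (n - k) ≤ 2 * n * N :=
      hN.trans (Nat.mul_le_mul_right N (by rw [pow_succ]; omega))
    exact_mod_cast h2
  calc _ ≤ (1 - separationBound n k) ^ N := hprob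
    _ ≤ Real.exp (-separationBound n k) ^ N :=
      pow_le_pow_left₀ (by linarith) (Real.one_sub_le_exp_neg _) N
    _ = Real.exp (-(separationBound n k * N)) := by
      rw [← Real.exp_nat_mul]
      congr 1
      ring
    _ ≤ Real.exp (-n) := by
      rw [Real.exp_le_exp, neg_le_neg_iff]
      exact le_separationBound_mul hL hLn hk hN2

lemma eventually_four_mul_logb_sq_le : ∀ᶠ n : ℕ in atTop, 4 * Real.logb 2 n ^ 2 ≤ n := by
  have h := (Real.isLittleO_pow_log_id_atTop (n := 2)).bound
    (c := Real.log 2 ^ 2 / 4) (by have := Real.log_pos one_lt_two; positivity)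
  filter_upwards [tendsto_natCast_atTop_atTop.eventually h] with n hn
  have hlog : 0 < Real.log 2 := Real.log_pos one_lt_two
  simp only [id, Real.norm_eq_abs, abs_pow, sq_abs, Nat.abs_cast] at hn
  rw [Real.logb, div_pow, mul_div_assoc', div_le_iff₀ (by positivity)]
  linarith

end Asymptotics

/-- Let `k = k(n)` be a sequence of integers with
`1 ≤ k(n) ≤ ⌊log₂ n − 2·log₂log₂ n⌋` (for all `n` large enough that this floor is
at least `1`). Then w.h.p. `Q^n(k(n))` is disconnected. -/
theorem stmt_4 (k : ℕ → ℕ)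
    (hk : ∀ᶠ n : ℕ in atTop,
      1 ≤ k n ∧ (k n : ℤ) ≤ ⌊Real.logb 2 n - 2 * Real.logb 2 (Real.logb 2 n)⌋) :
    Tendsto (fun n : ℕ =>
        prob (fun ω : KOut n (k n) => ¬ (kOutGraph n (k n) ω).Connected))
      atTop (nhds 1) := by
  have hlim : Tendsto (fun n : ℕ => 1 - Real.exp (-n)) atTop (nhds 1) := by
    simpa using (Real.tendsto_exp_neg_atTop_nhds_zero.comp
      tendsto_natCast_atTop_atTop).const_sub (1 : ℝ)
  have hlog : ∀ᶠ n : ℕ in atTop, 4 ≤ Real.logb 2 n :=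
    ((Real.tendsto_logb_atTop one_lt_two).comp
      tendsto_natCast_atTop_atTop).eventually_ge_atTop 4
  have hmain : ∀ᶠ n : ℕ in atTop, k n < n ∧
      prob (fun ω : KOut n (k n) => (kOutGraph n (k n) ω).Connected) ≤ Real.exp (-n) := by
    filter_upwards [hk, hlog, eventually_four_mul_logb_sq_le] with n hkn hL hLn
    exact prob_connected_le_exp hL hLn (by exact_mod_cast Int.le_floor.1 hkn.2)
  refine tendsto_of_tendsto_of_tendsto_of_le_of_le' hlim tendsto_const_nhds ?_ ?_
  · filter_upwards [hmain] with n hn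
    have : ∀ v : Vtx n, Nonempty _ := nonempty_choices hn.1.le
    rw [prob_not]
    linarith [hn.2]
  · filter_upwards [hmain] with n hn
    have : ∀ v : Vtx n, Nonempty _ := nonempty_choices hn.1.le
    exact prob_le_one _
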